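/- Let k ≤ ℓ ≤ n be positive integers and let ρ ⊆ [n]^k be a pc-relation whose tuples have pairwise distinct entries. Then Aut ρ = Comp^n(Aut ρ̌); in particular, the automorphism group of any pc-relation is a Galois closed subgroup of S_n under the monotone Galois connection (gPat_ℓ, gComp^n). -/

import Mathlib

open Equiv Finset Function

/-- `h_I : [ℓ] → [n]`: the increasing enumeration of an `ℓ`-element subset `I ⊆ [n]`,
i.e., the unique order isomorphism `([ℓ], ≤) → (I, ≤)` viewed as a map into `[n]`. -/
def hmap {ℓ n : ℕ} (I : Finset (Fin n)) (hI : I.card = ℓ) : Fin ℓ → Fin n :=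
  fun i => ((I.orderIsoOfFin hI) i : Fin n)

theorem hmap_injective {ℓ n : ℕ} (I : Finset (Fin n)) (hI : I.card = ℓ) :
    Function.Injective (hmap I hI) := fun a b h =>
  (I.orderIsoOfFin hI).injective (Subtype.ext h)

theorem mem_image_iff_perm {n : ℕ} (π : Equiv.Perm (Fin n)) (I : Finset (Fin n)) (a : Fin n) :
    a ∈ I ↔ π a ∈ I.image ⇑π := by
  constructor
  · exact fun h => Finset.mem_image_of_mem _ h
  · intro h
    obtain ⟨b, hb, hba⟩ := Finset.mem_image.mp h
    rwa [← π.injective hba]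

/-- The pattern `π_I := h_{π(I)}⁻¹ ∘ π ∘ h_I ∈ S_ℓ` of `π ∈ S_n` at an `ℓ`-element
subset `I ⊆ [n]`. -/
def patt {ℓ n : ℕ} (π : Equiv.Perm (Fin n)) (I : Finset (Fin n)) (hI : I.card = ℓ) :
    Equiv.Perm (Fin ℓ) :=
  (I.orderIsoOfFin hI).toEquiv.trans
    ((π.subtypeEquiv (mem_image_iff_perm π I)).trans
      ((I.image ⇑π).orderIsoOfFin
        (by rw [Finset.card_image_of_injective _ π.injective, hI])).toEquiv.symm)

/-- `Pat_ℓ(π)`: the set of `ℓ`-patterns of `π ∈ S_n`. -/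
def PattSet (ℓ : ℕ) {n : ℕ} (π : Equiv.Perm (Fin n)) : Set (Equiv.Perm (Fin ℓ)) :=
  {σ | ∃ (I : Finset (Fin n)) (hI : I.card = ℓ), σ = patt π I hI}

/-- `Comp^n(S)`: the set of `n`-permutations all of whose `ℓ`-patterns lie in `S`. -/
def CompSet (n : ℕ) {ℓ : ℕ} (S : Set (Equiv.Perm (Fin ℓ))) : Set (Equiv.Perm (Fin n)) :=
  {τ | PattSet ℓ τ ⊆ S}

/-- Pattern involvement: `σ ≤ π` iff `σ = π_I` for some `ℓ`-element subset `I`. -/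
def Involves {ℓ n : ℕ} (σ : Equiv.Perm (Fin ℓ)) (π : Equiv.Perm (Fin n)) : Prop :=
  σ ∈ PattSet ℓ π

/-- `gPat_ℓ(H)`: the subgroup of `S_ℓ` generated by the `ℓ`-patterns of members of `H`. -/
def gPat (ℓ : ℕ) {n : ℕ} (H : Set (Equiv.Perm (Fin n))) : Subgroup (Equiv.Perm (Fin ℓ)) :=
  Subgroup.closure (⋃ τ ∈ H, PattSet ℓ τ)

/-- A function preserves a `k`-ary relation (componentwise application keeps tuples in
the relation). -/
def Preserves {α : Type*} {k : ℕ} (f : α → α) (ρ : Set (Fin k → α)) : Prop :=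
  ∀ r ∈ ρ, (f ∘ r) ∈ ρ

/-- The `ℓ`-orbit `a^H = {σ ∘ a : σ ∈ H}`. -/
def orbitRel {ℓ n : ℕ} (H : Subgroup (Equiv.Perm (Fin n))) (a : Fin ℓ → Fin n) :
    Set (Fin ℓ → Fin n) :=
  {x | ∃ σ ∈ H, x = ⇑σ ∘ a}

/-- The reduction `red(u) = h_{range u}⁻¹ ∘ u` of a tuple with pairwise distinct
entries. -/
def red {k n : ℕ} (u : Fin k → Fin n) (hu : Function.Injective u) : Fin k → Fin k :=
  fun i =>
    ((Finset.univ.image u).orderIsoOfFin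
      (by rw [Finset.card_image_of_injective _ hu]; simp)).symm
      ⟨u i, Finset.mem_image_of_mem _ (Finset.mem_univ i)⟩

/-- `red(ρ) = {red(r) : r ∈ ρ}` for a set `ρ` of tuples with pairwise distinct entries. -/
def redSet {k n : ℕ} (ρ : Set (Fin k → Fin n)) : Set (Fin k → Fin k) :=
  {v | ∃ (r : Fin k → Fin n) (_ : r ∈ ρ) (hr : Function.Injective r), v = red r hr}

/-- `ρ̌ := {h_I⁻¹ ∘ r : r ∈ ρ, range r ⊆ I, I an ℓ-element subset of [n]}`. -/
def checkRel (ℓ : ℕ) {k n : ℕ} (ρ : Set (Fin k → Fin n)) : Set (Fin k → Fin ℓ) :=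
  {s | ∃ (r : Fin k → Fin n) (_ : r ∈ ρ) (I : Finset (Fin n)) (hI : I.card = ℓ)
        (hr : ∀ j, r j ∈ I), s = fun j => (I.orderIsoOfFin hI).symm ⟨r j, hr j⟩}

/-- `σ̂ := {h_J ∘ s : s ∈ σ, J an ℓ-element subset of [n]}`. -/
def hatRel (n : ℕ) {k ℓ : ℕ} (σ : Set (Fin k → Fin ℓ)) : Set (Fin k → Fin n) :=
  {r | ∃ (s : Fin k → Fin ℓ) (_ : s ∈ σ) (J : Finset (Fin n)) (hJ : J.card = ℓ),
        r = hmap J hJ ∘ s}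

/-- `ρ` is a pattern closed relation (pc-relation): for every `r ∈ ρ` and all
`ℓ`-element subsets `I, J ⊆ [n]` with `range r ⊆ I`, the tuple `h_J ∘ h_I⁻¹ ∘ r`
belongs to `ρ`. -/
def IsPC (ℓ : ℕ) {k n : ℕ} (ρ : Set (Fin k → Fin n)) : Prop :=
  ∀ r ∈ ρ, ∀ (I J : Finset (Fin n)) (hI : I.card = ℓ) (hJ : J.card = ℓ)
    (hr : ∀ j, r j ∈ I),
    (fun j => hmap J hJ ((I.orderIsoOfFin hI).symm ⟨r j, hr j⟩)) ∈ ρ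
theorem hmap_symm_apply {ℓ n : ℕ} (I : Finset (Fin n)) (hI : I.card = ℓ) (x : I) :
    hmap I hI ((I.orderIsoOfFin hI).symm x) = x := by
  simp [hmap]

theorem hmap_mem {ℓ n : ℕ} (I : Finset (Fin n)) (hI : I.card = ℓ) (i : Fin ℓ) :
    hmap I hI i ∈ I :=
  ((I.orderIsoOfFin hI) i).2

theorem hmap_patt {ℓ n : ℕ} (π : Equiv.Perm (Fin n)) (I : Finset (Fin n)) (hI : I.card = ℓ)
    (hπI : (I.image ⇑π).card = ℓ) (i : Fin ℓ) :
    hmap (I.image ⇑π) hπI (patt π I hI i) = π (hmap I hI i) :=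
  hmap_symm_apply _ hπI _

/-- For a pc-relation, membership in `ρ̌` may be tested on any `ℓ`-element subset. -/
theorem IsPC.mem_checkRel_iff {k ℓ n : ℕ} {ρ : Set (Fin k → Fin n)} (hpc : IsPC ℓ ρ)
    (J : Finset (Fin n)) (hJ : J.card = ℓ) (s : Fin k → Fin ℓ) :
    s ∈ checkRel ℓ ρ ↔ hmap J hJ ∘ s ∈ ρ := by
  constructor
  · rintro ⟨r, hr, I, hI, hrI, rfl⟩
    exact hpc r hr I J hI hJ hrI
  · intro h
    refine ⟨_, h, J, hJ, fun j => hmap_mem J hJ (s j), funext fun j => ?_⟩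
    exact ((J.orderIsoOfFin hJ).symm_apply_apply (s j)).symm

/-- The permutations preserving a relation, as a submonoid. -/
def preservingSubmonoid {α : Type*} {k : ℕ} (ρ : Set (Fin k → α)) :
    Submonoid (Equiv.Perm α) where
  carrier := {g | Preserves ⇑g ρ}
  one_mem' := fun _ hr => hr
  mul_mem' := fun ha hb _ hr => ha _ (hb _ hr)

theorem IsPC.preserves_patt {k ℓ n : ℕ} {ρ : Set (Fin k → Fin n)} (hpc : IsPC ℓ ρ)
    {π : Equiv.Perm (Fin n)} (hπ : Preserves ⇑π ρ) (I : Finset (Fin n)) (hI : I.card = ℓ) :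
    Preserves ⇑(patt π I hI) (checkRel ℓ ρ) := by
  intro s hs
  have hπI : (I.image ⇑π).card = ℓ := by
    rw [Finset.card_image_of_injective _ π.injective, hI]
  rw [hpc.mem_checkRel_iff _ hπI]
  have h := hπ _ ((hpc.mem_checkRel_iff I hI s).1 hs)
  convert h using 1
  exact funext fun j => hmap_patt π I hI hπI (s j)

/-- A permutation whose `ℓ`-patterns all preserve `ρ̌` preserves `ρ`. -/
theorem IsPC.preserves_of_patt {k ℓ n : ℕ} (hkl : k ≤ ℓ) (hln : ℓ ≤ n)
    {ρ : Set (Fin k → Fin n)} (hpc : IsPC ℓ ρ) {π : Equiv.Perm (Fin n)}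
    (hπ : ∀ (I : Finset (Fin n)) (hI : I.card = ℓ),
      Preserves ⇑(patt π I hI) (checkRel ℓ ρ)) :
    Preserves ⇑π ρ := by
  intro r hr
  obtain ⟨I, hrI, hI⟩ := Finset.exists_superset_card_eq (s := Finset.univ.image r) (n := ℓ)
    (Finset.card_image_le.trans (by simpa using hkl)) (by simpa using hln)
  have hmem : ∀ j, r j ∈ I := fun j => hrI (Finset.mem_image_of_mem _ (Finset.mem_univ j))
  have hπI : (I.image ⇑π).card = ℓ := by
    rw [Finset.card_image_of_injective _ π.injective, hI]
  have h := (hpc.mem_checkRel_iff _ hπI _).1 (hπ I hI _ ⟨r, hr, I, hI, hmem, rfl⟩)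
  convert h using 1
  funext j
  simp only [Function.comp_apply, hmap_patt, hmap_symm_apply]

/-- Proposition 5.6: for a pc-relation `ρ ⊆ [n]^k_≠` (`k ≤ ℓ ≤ n`):
`Aut ρ = Comp^n(Aut ρ̌)`; in particular `Aut ρ` is Galois closed under
`(gPat_ℓ, gComp^n)`, i.e., `gComp^n(gPat_ℓ(Aut ρ)) = Aut ρ`. -/
theorem stmt17 (k ℓ n : ℕ) (hk : 0 < k) (hkl : k ≤ ℓ) (hln : ℓ ≤ n)
    (ρ : Set (Fin k → Fin n)) (hinj : ∀ r ∈ ρ, Function.Injective r)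
    (hpc : IsPC ℓ ρ) :
    {π : Equiv.Perm (Fin n) | Preserves ⇑π ρ} =
        CompSet n {g : Equiv.Perm (Fin ℓ) | Preserves ⇑g (checkRel ℓ ρ)} ∧
      CompSet n ((gPat ℓ {π : Equiv.Perm (Fin n) | Preserves ⇑π ρ}) :
          Set (Equiv.Perm (Fin ℓ))) =
        {π : Equiv.Perm (Fin n) | Preserves ⇑π ρ} := by
  have haut : {π : Equiv.Perm (Fin n) | Preserves ⇑π ρ} =
      CompSet n {g : Equiv.Perm (Fin ℓ) | Preserves ⇑g (checkRel ℓ ρ)} := by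
    ext π
    constructor
    · rintro hπ _ ⟨I, hI, rfl⟩
      exact hpc.preserves_patt hπ I hI
    · exact fun hπ => hpc.preserves_of_patt hkl hln fun I hI => hπ ⟨I, hI, rfl⟩
  refine ⟨haut, Set.Subset.antisymm ?_ ?_⟩
  · have hle : (gPat ℓ {π : Equiv.Perm (Fin n) | Preserves ⇑π ρ}).toSubmonoid ≤
        preservingSubmonoid (checkRel ℓ ρ) := by
      rw [gPat, Subgroup.closure_toSubmonoid_of_finite, Submonoid.closure_le]
      refine Set.iUnion₂_subset ?_
      rintro π hπ _ ⟨I, hI, rfl⟩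
      exact hpc.preserves_patt hπ I hI
    intro π hπ
    rw [haut]
    exact fun σ hσ => hle (hπ hσ)
  · exact fun π hπ σ hσ => Subgroup.subset_closure (Set.mem_biUnion hπ hσ)
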